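/- Fix s, α > 0 and let k(x,y) = s² exp(−α‖x−y‖²) on ℝ^d. Let (x_n)_{n≥1} be a sequence in ℝ^d such that the closure of {x_n : n ≥ 1} has non-empty interior. Then for EVERY x ∈ ℝ^d, the kriging variance σ²(x; x₁,…,x_n) converges to 0 as n → ∞. -/

import Mathlib

open Filter

/-- The quadratic form `Qₙ(λ)`. -/
noncomputable def krigQ {d : ℕ}
    (k : EuclideanSpace ℝ (Fin d) → EuclideanSpace ℝ (Fin d) → ℝ)
    (x : EuclideanSpace ℝ (Fin d)) {n : ℕ}
    (pts : Fin n → EuclideanSpace ℝ (Fin d)) (lam : Fin n → ℝ) : ℝ :=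
  k x x - 2 * ∑ i, lam i * k x (pts i)
    + ∑ i, ∑ j, lam i * lam j * k (pts i) (pts j)

/-- The kriging variance `σ²(x; x₁,…,x_n) = inf_{λ ∈ ℝⁿ} Qₙ(λ)`. -/
noncomputable def krigVar {d : ℕ}
    (k : EuclideanSpace ℝ (Fin d) → EuclideanSpace ℝ (Fin d) → ℝ)
    (x : EuclideanSpace ℝ (Fin d)) {n : ℕ}
    (pts : Fin n → EuclideanSpace ℝ (Fin d)) : ℝ :=
  ⨅ lam : Fin n → ℝ, krigQ k x pts lam

/-- Unnormalised Fock-space features. -/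
noncomputable def fockFeat {d : ℕ} (u : Fin d → ℝ) (i : Σ m : ℕ, (Fin m → Fin d)) : ℝ :=
  (∏ j, u (i.2 j)) / Real.sqrt (Nat.factorial i.1)

lemma fock_inner_sum {d : ℕ} (u w : Fin d → ℝ) (m : ℕ) :
    ∑ f : Fin m → Fin d, fockFeat u ⟨m, f⟩ * fockFeat w ⟨m, f⟩
      = (∑ k, u k * w k) ^ m / (Nat.factorial m) := by
  have h1 : ∀ f : Fin m → Fin d, fockFeat u ⟨m, f⟩ * fockFeat w ⟨m, f⟩
      = (∏ j, (u (f j) * w (f j))) / (Nat.factorial m) := by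
    intro f
    unfold fockFeat
    simp only
    rw [div_mul_div_comm, Real.mul_self_sqrt (by positivity), Finset.prod_mul_distrib]
  simp_rw [h1]
  rw [← Finset.sum_div]
  congr 1
  have := Finset.prod_univ_sum (fun _ : Fin m => (Finset.univ : Finset (Fin d)))
    (fun _ k => u k * w k)
  simpa using this.symm

lemma fock_abs {d : ℕ} (u : Fin d → ℝ) (i : Σ m : ℕ, (Fin m → Fin d)) :
    |fockFeat u i| = fockFeat (fun k => |u k|) i := by
  unfold fockFeat
  rw [abs_div, Finset.abs_prod, abs_of_nonneg (Real.sqrt_nonneg _)]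

lemma fock_summable {d : ℕ} (u w : Fin d → ℝ) :
    Summable (fun i => fockFeat u i * fockFeat w i) := by
  apply Summable.of_norm
  simp only [Real.norm_eq_abs, abs_mul, fock_abs]
  rw [summable_sigma_of_nonneg]
  · refine ⟨fun m => Summable.of_finite, ?_⟩
    simp_rw [tsum_fintype, fock_inner_sum]
    exact Real.summable_pow_div_factorial _
  · intro i
    rw [← fock_abs, ← fock_abs]
    positivity

lemma fock_tsum {d : ℕ} (u w : Fin d → ℝ) :
    ∑' i, fockFeat u i * fockFeat w i = Real.exp (∑ k, u k * w k) := by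
  rw [(fock_summable u w).tsum_sigma]
  simp_rw [tsum_fintype, fock_inner_sum]
  rw [Real.exp_eq_exp_ℝ, NormedSpace.exp_eq_tsum_div]

lemma fock_mem {d : ℕ} (u : Fin d → ℝ) :
    Memℓp (fockFeat u) 2 := by
  apply memℓp_gen
  have := fock_summable u u
  refine this.congr ?_
  intro i
  simp [sq]

/-- Feature vector in `ℓ²`. -/
noncomputable def fockVec {d : ℕ} (u : Fin d → ℝ) :
    lp (fun _ : (Σ m : ℕ, (Fin m → Fin d)) => ℝ) 2 := ⟨fockFeat u, fock_mem u⟩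

lemma fockVec_inner {d : ℕ} (u w : Fin d → ℝ) :
    inner ℝ (fockVec u) (fockVec w) = Real.exp (∑ k, u k * w k) := by
  rw [lp.inner_eq_tsum, ← fock_tsum]
  apply tsum_congr
  intro i
  simp [fockVec, mul_comm]

lemma fock_entire {d : ℕ} (h : lp (fun _ : (Σ m : ℕ, (Fin m → Fin d)) => ℝ) 2)
    (u v : Fin d → ℝ) :
    Differentiable ℂ (fun z : ℂ => ∑' i : (Σ m : ℕ, (Fin m → Fin d)), ((h i : ℝ) : ℂ) *
      ((∏ j, ((u (i.2 j) : ℂ) + z * (v (i.2 j) : ℂ))) / (Real.sqrt (Nat.factorial i.1) : ℂ))) := by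
  intro z
  have hR : ∃ R : ℝ, ‖z‖ < R := ⟨‖z‖ + 1, by linarith⟩
  obtain ⟨R, hR⟩ := hR
  have hR0 : 0 < R := lt_of_le_of_lt (norm_nonneg _) hR
  have key : DifferentiableOn ℂ (fun z : ℂ => ∑' i : (Σ m : ℕ, (Fin m → Fin d)), ((h i : ℝ) : ℂ) *
      ((∏ j, ((u (i.2 j) : ℂ) + z * (v (i.2 j) : ℂ))) / (Real.sqrt (Nat.factorial i.1) : ℂ)))
      (Metric.ball 0 R) := by
    refine Complex.differentiableOn_tsum_of_summable_norm
      (u := fun i => |h i * fockFeat (fun k => |u k| + R * |v k|) i|) ?_ ?_ Metric.isOpen_ball ?_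
    · have := lp.summable_inner (𝕜 := ℝ) h (fockVec (fun k => |u k| + R * |v k|))
      refine this.abs.congr ?_
      intro i
      simp [fockVec, mul_comm]
    · intro i
      apply Differentiable.differentiableOn
      fun_prop
    · intro i w hw
      have hw' : ‖w‖ ≤ R := by simpa using (le_of_lt (by simpa using hw))
      rw [norm_mul, abs_mul, Complex.norm_real, Real.norm_eq_abs, fock_abs]
      refine mul_le_mul_of_nonneg_left ?_ (abs_nonneg _)
      unfold fockFeat
      rw [norm_div, Complex.norm_real, Real.norm_eq_abs, abs_of_nonneg (Real.sqrt_nonneg _),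
        norm_prod]
      refine div_le_div_of_nonneg_right ?_ (Real.sqrt_nonneg _)
      refine Finset.prod_le_prod (fun _ _ => norm_nonneg _) ?_
      intro j _
      refine le_trans ?_ (le_abs_self _)
      refine (norm_add_le _ _).trans ?_
      rw [norm_mul, Complex.norm_real, Complex.norm_real, Real.norm_eq_abs, Real.norm_eq_abs]
      gcongr
  exact (key z (by simpa using hR)).differentiableAt (Metric.isOpen_ball.mem_nhds (by simpa using hR))

lemma fock_identity {d : ℕ} (h : lp (fun _ : (Σ m : ℕ, (Fin m → Fin d)) => ℝ) 2)
    (u v : Fin d → ℝ)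
    (h0 : ∀ᶠ t : ℝ in nhds 0, inner ℝ h (fockVec (fun k => u k + t * v k)) = 0) (t : ℝ) :
    inner ℝ h (fockVec (fun k => u k + t * v k)) = 0 := by
  set F := (fun z : ℂ => ∑' i : (Σ m : ℕ, (Fin m → Fin d)), ((h i : ℝ) : ℂ) *
      ((∏ j, ((u (i.2 j) : ℂ) + z * (v (i.2 j) : ℂ))) / (Real.sqrt (Nat.factorial i.1) : ℂ))) with hF
  have hFt : ∀ t : ℝ, F t = ((inner ℝ h (fockVec (fun k => u k + t * v k)) : ℝ) : ℂ) := by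
    intro t
    rw [lp.inner_eq_tsum, Complex.ofReal_tsum]
    apply tsum_congr
    intro i
    simp [fockVec, fockFeat, mul_comm]
  have hd : AnalyticOnNhd ℂ F Set.univ :=
    (fock_entire h u v).differentiableOn.analyticOnNhd isOpen_univ
  have hfreq : ∃ᶠ z in nhdsWithin (0 : ℂ) {0}ᶜ, F z = 0 := by
    have ht : Tendsto (fun t : ℝ => (t : ℂ)) (nhdsWithin 0 {0}ᶜ) (nhdsWithin (0 : ℂ) {0}ᶜ) := by
      refine tendsto_nhdsWithin_iff.2 ⟨?_, ?_⟩
      · have := Complex.continuous_ofReal.tendsto 0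
        simpa using this.mono_left nhdsWithin_le_nhds
      · filter_upwards [self_mem_nhdsWithin] with a ha
        simpa using ha
    refine ht.frequently ?_
    apply Eventually.frequently
    filter_upwards [nhdsWithin_le_nhds h0] with a ha
    rw [hFt, ha]; simp
  have := hd.eqOn_zero_of_preconnected_of_frequently_eq_zero isPreconnected_univ
    (Set.mem_univ 0) hfreq (Set.mem_univ (t : ℂ))
  rw [hFt] at this
  simpa using this

/-- For the Gaussian covariance `k(x,y) = s² exp(−α‖x−y‖²)`, if the closure of the set
of design points has non-empty interior, then the kriging variance tends to `0`
at *every* point `x ∈ ℝ^d`. -/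
theorem gaussian_kernel_krigVar_tendsto_zero_everywhere {d : ℕ}
    (s α : ℝ) (hs : 0 < s) (hα : 0 < α)
    (k : EuclideanSpace ℝ (Fin d) → EuclideanSpace ℝ (Fin d) → ℝ)
    (hk : ∀ x y, k x y = s ^ 2 * Real.exp (-α * ‖x - y‖ ^ 2))
    (xs : ℕ → EuclideanSpace ℝ (Fin d))
    (hint : (interior (closure (Set.range xs))).Nonempty)
    (x : EuclideanSpace ℝ (Fin d)) :
    Tendsto (fun n : ℕ => krigVar k x (fun i : Fin n => xs i)) atTop (nhds 0) := by
  classical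
  set β := Real.sqrt (2 * α) with hβ
  have hββ : β * β = 2 * α := Real.mul_self_sqrt (by positivity)
  let Φ : EuclideanSpace ℝ (Fin d) → lp (fun _ : (Σ m : ℕ, (Fin m → Fin d)) => ℝ) 2 :=
    fun y => (s * Real.exp (-α * ‖y‖ ^ 2)) • fockVec (fun k => β * y k)
  have hΦ : ∀ y z, inner ℝ (Φ y) (Φ z) = k y z := by
    intro y z
    simp only [Φ]
    rw [real_inner_smul_left, real_inner_smul_right, fockVec_inner, hk]
    have e1 : ∑ i, β * y i * (β * z i) = 2 * α * inner ℝ y z := by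
      rw [PiLp.inner_apply, Finset.mul_sum]
      refine Finset.sum_congr rfl fun i _ => ?_
      rw [← hββ]
      simp
      ring
    rw [e1, norm_sub_sq_real]
    have e2 : -α * (‖y‖ ^ 2 - 2 * inner ℝ y z + ‖z‖ ^ 2)
      = -α * ‖y‖ ^ 2 + (-α * ‖z‖ ^ 2 + 2 * α * inner ℝ y z) := by ring
    rw [e2, Real.exp_add, Real.exp_add]
    ring
  have hQ : ∀ (n : ℕ) (lam : Fin n → ℝ), krigQ k x (fun i : Fin n => xs i) lam
      = ‖Φ x - ∑ i, lam i • Φ (xs i)‖ ^ 2 := by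
    intro n lam
    rw [norm_sub_sq_real, ← real_inner_self_eq_norm_sq, ← real_inner_self_eq_norm_sq]
    simp only [inner_sum, sum_inner, real_inner_smul_left, real_inner_smul_right, hΦ]
    unfold krigQ
    congr 1
    rw [Finset.sum_comm]
    refine Finset.sum_congr rfl fun i _ => Finset.sum_congr rfl fun j _ => ?_
    ring
  have hcont : Continuous Φ := by
    rw [continuous_iff_continuousAt]
    intro y
    rw [ContinuousAt, tendsto_iff_norm_sub_tendsto_zero]
    have e : ∀ z, ‖Φ z - Φ y‖ = Real.sqrt (k z z - 2 * k z y + k y y) := by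
      intro z
      rw [← hΦ, ← hΦ, ← hΦ, real_inner_self_eq_norm_sq, real_inner_self_eq_norm_sq,
        ← norm_sub_sq_real, Real.sqrt_sq (norm_nonneg _)]
    simp_rw [e, hk]
    have hc : Continuous (fun z : EuclideanSpace ℝ (Fin d) =>
      Real.sqrt (s ^ 2 * Real.exp (-α * ‖z - z‖ ^ 2) - 2 * (s ^ 2 * Real.exp (-α * ‖z - y‖ ^ 2))
        + s ^ 2 * Real.exp (-α * ‖y - y‖ ^ 2))) := by fun_prop
    have := hc.tendsto y
    convert this using 2
    simp
    ring_nf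
    simp
  -- main step
  let V : Submodule ℝ (lp (fun _ : (Σ m : ℕ, (Fin m → Fin d)) => ℝ) 2) :=
    Submodule.span ℝ (Set.range fun n => Φ (xs n))
  have hmem : Φ x ∈ V.topologicalClosure := by
    rw [← Submodule.orthogonal_orthogonal_eq_closure, Submodule.mem_orthogonal]
    intro h hh
    have hz : ∀ n, inner ℝ h (Φ (xs n)) = 0 := by
      intro n
      have hV : Φ (xs n) ∈ V := Submodule.subset_span (Set.mem_range_self n)
      exact Submodule.inner_left_of_mem_orthogonal hV hh
    have hcl : ∀ y ∈ closure (Set.range xs), inner ℝ h (Φ y) = 0 := by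
      have hc : IsClosed {y | inner ℝ h (Φ y) = (0 : ℝ)} :=
        isClosed_eq (by fun_prop) continuous_const
      intro y hy
      exact closure_minimal (t := {y | inner ℝ h (Φ y) = (0 : ℝ)})
        (by rintro _ ⟨n, rfl⟩; exact hz n) hc hy
    obtain ⟨y0, hy0⟩ := hint
    have hne : ∀ y : EuclideanSpace ℝ (Fin d), s * Real.exp (-α * ‖y‖ ^ 2) ≠ 0 :=
      fun y => by positivity
    have hev : ∀ᶠ t : ℝ in nhds 0, inner ℝ h
        (fockVec (fun k => β * y0 k + t * (β * (x k - y0 k)))) = 0 := by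
      have hc : Continuous (fun t : ℝ => y0 + t • (x - y0)) := by fun_prop
      have : ∀ᶠ t : ℝ in nhds 0, y0 + t • (x - y0) ∈ interior (closure (Set.range xs)) := by
        apply hc.continuousAt.eventually_mem
        exact isOpen_interior.mem_nhds (by simpa using hy0)
      filter_upwards [this] with t ht
      have h1 := hcl _ (interior_subset ht)
      simp only [Φ] at h1
      rw [real_inner_smul_right] at h1
      have h2 := (mul_eq_zero.1 h1).resolve_left (hne _)
      rw [← h2]
      congr 2
      ext k
      simp
      ring
    have h1 := fock_identity h _ _ hev 1
    simp only [Φ]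
    rw [real_inner_smul_right]
    have : (fun k => β * y0 k + 1 * (β * (x k - y0 k))) = fun k => β * x k := by
      ext k; ring
    rw [this] at h1
    rw [h1, mul_zero]
  have hnonneg : ∀ n, 0 ≤ krigVar k x (fun i : Fin n => xs i) := by
    intro n
    exact Real.iInf_nonneg fun lam => by rw [hQ]; positivity
  rw [Metric.tendsto_atTop]
  intro ε hε
  have hmem' : Φ x ∈ closure (V : Set _) := hmem
  obtain ⟨w, hw, hdist⟩ := Metric.mem_closure_iff.1 hmem' (Real.sqrt ε) (Real.sqrt_pos.2 hε)
  obtain ⟨c, hc⟩ := (Finsupp.mem_span_range_iff_exists_finsupp).1 hw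
  refine ⟨c.support.sup id + 1, fun n hn => ?_⟩
  have hle : krigVar k x (fun i : Fin n => xs i) ≤ krigQ k x (fun i : Fin n => xs i) (fun i => c i) :=
    ciInf_le ⟨0, by rintro _ ⟨lam, rfl⟩; simp only [hQ]; positivity⟩ _
  have hsum : ∑ i : Fin n, c i • Φ (xs i) = w := by
    rw [← hc, Fin.sum_univ_eq_sum_range (fun i => c i • Φ (xs i)), Finsupp.sum]
    symm
    refine Finset.sum_subset ?_ ?_
    · intro i hi
      have : id i ≤ c.support.sup id := Finset.le_sup hi
      simp at this ⊢
      omega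
    · intro i _ hi
      simp [Finsupp.notMem_support_iff.1 hi]
  rw [hQ, hsum, ← dist_eq_norm] at hle
  rw [Real.dist_eq, sub_zero, abs_of_nonneg (hnonneg n)]
  refine hle.trans_lt ?_
  calc dist (Φ x) w ^ 2 < Real.sqrt ε ^ 2 := by gcongr
    _ = ε := Real.sq_sqrt hε.le
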